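/- Suppose P(|G| ≥ μ) = 1 for some constant μ > 0 and E[G²] < ∞. Then as σ → 0: |χ*(σ) − χ**| = O( φ(χ** − μ/σ) ). -/

import Mathlib

open MeasureTheory ProbabilityTheory Real Filter Set Asymptotics

noncomputable section

/-- The standard Gaussian measure on `ℝ`. -/
def stdGaussian : Measure ℝ := gaussianReal 0 1

/-- Soft thresholding, i.e. `η₁(u;χ) = sign(u)·max(|u|−χ,0)`. -/
def soft (u χ : ℝ) : ℝ := Real.sign u * max (|u| - χ) 0

/-- The law of `B`: the mixture `(1−ε)δ₀ + ε·g`. -/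
def mix (ε : ℝ) (g : Measure ℝ) : Measure ℝ :=
  ENNReal.ofReal (1 - ε) • Measure.dirac (0:ℝ) + ENNReal.ofReal ε • g

/-- `R(χ,σ) = E[(η₁(B/σ+Z;χ) − B/σ)²]` with `B ~ (1−ε)δ₀+εg`, `Z ~ N(0,1)` independent. -/
def R1 (ε : ℝ) (g : Measure ℝ) (χ σ : ℝ) : ℝ :=
  ∫ b, (∫ z, (soft (b/σ + z) χ - b/σ)^2 ∂stdGaussian) ∂(mix ε g)

/-- `ψ(χ) = (1−ε)·E[η₁(Z;χ)²] + ε(1+χ²)`. -/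
def psi (ε χ : ℝ) : ℝ :=
  (1 - ε) * ∫ z, (soft z χ)^2 ∂stdGaussian + ε * (1 + χ^2)

/-- The standard normal density. -/
def phi (x : ℝ) : ℝ := (Real.sqrt (2 * Real.pi))⁻¹ * Real.exp (-x^2/2)

instance : IsProbabilityMeasure stdGaussian := by
  unfold _root_.stdGaussian; infer_instance

lemma soft_eq {u χ : ℝ} (hχ : 0 ≤ χ) : soft u χ = max (u - χ) 0 - max (-u - χ) 0 := by
  unfold soft
  rcases lt_trichotomy u 0 with h | h | h
  · rw [Real.sign_of_neg h, abs_of_neg h, max_eq_right (by linarith : u - χ ≤ 0)]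
    ring
  · subst h
    simp
  · rw [Real.sign_of_pos h, abs_of_pos h, max_eq_right (by linarith : -u - χ ≤ 0)]
    ring

lemma soft_neg {u χ : ℝ} (hχ : 0 ≤ χ) : soft (-u) χ = -soft u χ := by
  rw [soft_eq hχ, soft_eq hχ, neg_neg]; ring

lemma soft_sq {u χ : ℝ} (hχ : 0 ≤ χ) : soft u χ ^ 2 = max (|u| - χ) 0 ^ 2 := by
  rw [soft_eq hχ]
  rcases abs_cases u with ⟨h, h'⟩ | ⟨h, h'⟩ <;> rw [h]
  · rw [max_eq_right (by linarith : -u - χ ≤ 0), sub_zero]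
  · rw [max_eq_right (by linarith : u - χ ≤ 0)]; ring

lemma continuous_soft {χ : ℝ} (hχ : 0 ≤ χ) : Continuous fun u => soft u χ := by
  have : (fun u => soft u χ) = fun u => max (u - χ) 0 - max (-u - χ) 0 :=
    funext fun u => soft_eq hχ
  rw [this]; fun_prop

lemma abs_soft_sub_self_le {u χ : ℝ} (hχ : 0 ≤ χ) : |soft u χ - u| ≤ χ := by
  rw [soft_eq hχ, abs_le]
  constructor <;>
  rcases max_cases (u - χ) 0 with ⟨h, h'⟩ | ⟨h, h'⟩ <;>
  rcases max_cases (-u - χ) 0 with ⟨k, k'⟩ | ⟨k, k'⟩ <;> linarith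

lemma soft_of_le_neg {u χ : ℝ} (hχ : 0 ≤ χ) (h : u ≤ -χ) : soft u χ = u + χ := by
  rw [soft_eq hχ, max_eq_right (by linarith), max_eq_left (by linarith)]; ring

lemma abs_soft_sub_soft_le {u a b : ℝ} :
    |soft u a - soft u b| ≤ |a - b| := by
  unfold soft
  rw [← mul_sub, abs_mul]
  have h1 : |Real.sign u| ≤ 1 := by
    rcases Real.sign_apply_eq u with h | h | h <;> rw [h] <;> norm_num
  have h2 : |max (|u| - a) 0 - max (|u| - b) 0| ≤ |a - b| := by
    refine (abs_max_sub_max_le_abs _ _ _).trans_eq ?_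
    rw [abs_sub_comm]; congr 1; ring
  calc _ ≤ 1 * |a - b| := mul_le_mul h1 h2 (abs_nonneg _) zero_le_one
    _ = _ := one_mul _

/-- The risk of soft thresholding at level `χ` for the mean `θ` under standard Gaussian noise. -/
def risk (χ θ : ℝ) : ℝ := ∫ z, (soft (θ + z) χ - θ) ^ 2 ∂stdGaussian

lemma integrable_sq_stdGaussian : Integrable (fun z : ℝ => z ^ 2) stdGaussian :=
  (memLp_id_gaussianReal 2).integrable_sq

lemma integrable_id_stdGaussian : Integrable (fun z : ℝ => z) stdGaussian :=
  (memLp_id_gaussianReal 1).integrable (by norm_num)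

lemma integral_id_stdGaussian : ∫ z, z ∂stdGaussian = 0 := by
  unfold _root_.stdGaussian; exact integral_id_gaussianReal

lemma integral_sq_stdGaussian : ∫ z, z ^ 2 ∂stdGaussian = 1 := by
  have h := variance_id_gaussianReal (μ := 0) (v := 1)
  rw [variance_eq_integral (by fun_prop)] at h
  simpa [_root_.stdGaussian] using h

lemma integral_neg_stdGaussian (f : ℝ → ℝ) :
    ∫ z, f (-z) ∂stdGaussian = ∫ z, f z ∂stdGaussian := by
  have h : Measure.map (fun z => -z) _root_.stdGaussian = _root_.stdGaussian := by
    unfold _root_.stdGaussian; rw [gaussianReal_map_neg, neg_zero]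
  conv_rhs => rw [← h]
  exact ((MeasurableEquiv.neg ℝ).measurableEmbedding.integral_map f).symm

lemma loss_le {χ : ℝ} (hχ : 0 ≤ χ) (θ z : ℝ) :
    (soft (θ + z) χ - θ) ^ 2 ≤ 2 * z ^ 2 + 2 * χ ^ 2 := by
  obtain ⟨h1, h2⟩ := abs_le.1 (abs_soft_sub_self_le (u := θ + z) hχ)
  nlinarith [sq_nonneg (soft (θ + z) χ - θ - 2 * z)]

lemma integrable_loss {χ : ℝ} (hχ : 0 ≤ χ) (θ : ℝ) :
    Integrable (fun z => (soft (θ + z) χ - θ) ^ 2) stdGaussian := by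
  refine ((integrable_sq_stdGaussian.const_mul 2).add (integrable_const (2 * χ ^ 2))).mono'
    ?_ (ae_of_all _ fun z => ?_)
  · have := continuous_soft hχ
    exact Continuous.aestronglyMeasurable (by fun_prop)
  · rw [Real.norm_eq_abs, abs_of_nonneg (sq_nonneg _)]
    exact loss_le hχ θ z

lemma risk_le {χ : ℝ} (hχ : 0 ≤ χ) (θ : ℝ) : risk χ θ ≤ 2 + 2 * χ ^ 2 := by
  have h := integral_mono (integrable_loss hχ θ)
    ((integrable_sq_stdGaussian.const_mul 2).add (integrable_const (2 * χ ^ 2)))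
    (fun z => loss_le hχ θ z)
  simp only [Pi.add_apply] at h
  rw [integral_add (integrable_sq_stdGaussian.const_mul 2) (integrable_const _),
    integral_const_mul, integral_sq_stdGaussian] at h
  simpa [risk] using h

lemma risk_nonneg (χ θ : ℝ) : 0 ≤ risk χ θ := integral_nonneg fun _ => sq_nonneg _

lemma risk_neg {χ : ℝ} (hχ : 0 ≤ χ) (θ : ℝ) : risk χ (-θ) = risk χ θ := by
  unfold risk
  rw [← integral_neg_stdGaussian]
  refine integral_congr_ae (ae_of_all _ fun z => ?_)
  have : soft (-θ + -z) χ = -soft (θ + z) χ := by rw [← soft_neg hχ]; congr 1; ring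
  simp only [this]; ring

lemma stronglyMeasurable_risk {χ : ℝ} (hχ : 0 ≤ χ) : StronglyMeasurable (risk χ) := by
  have := continuous_soft hχ
  have h : Continuous (fun p : ℝ × ℝ => (soft (p.1 + p.2) χ - p.1) ^ 2) := by fun_prop
  exact h.stronglyMeasurable.integral_prod_right (ν := stdGaussian)

lemma integrable_risk {χ : ℝ} (hχ : 0 ≤ χ) (g : Measure ℝ) [IsFiniteMeasure g] (σ : ℝ) :
    Integrable (fun b => risk χ (b / σ)) g := by
  refine (integrable_const (2 + 2 * χ ^ 2)).mono' ?_ (ae_of_all _ fun b => ?_)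
  · exact ((stronglyMeasurable_risk hχ).comp_measurable (by fun_prop)).aestronglyMeasurable
  · rw [Real.norm_eq_abs, abs_of_nonneg (risk_nonneg _ _)]
    exact risk_le hχ _

lemma R1_eq {ε : ℝ} (hε : ε ∈ Ioo (0:ℝ) 1) (g : Measure ℝ) [IsProbabilityMeasure g]
    {χ : ℝ} (hχ : 0 ≤ χ) (σ : ℝ) :
    R1 ε g χ σ = (1 - ε) * ∫ z, (soft z χ) ^ 2 ∂stdGaussian + ε * ∫ b, risk χ (b / σ) ∂g := by
  have h : R1 ε g χ σ = ∫ b, risk χ (b / σ) ∂(mix ε g) := rfl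
  rw [h, mix, integral_add_measure, integral_smul_measure, integral_smul_measure, integral_dirac,
    ENNReal.toReal_ofReal (by linarith [hε.2]), ENNReal.toReal_ofReal hε.1.le]
  · simp [risk]
  · exact (integrable_risk hχ _ σ).smul_measure ENNReal.ofReal_ne_top
  · exact (integrable_risk hχ _ σ).smul_measure ENNReal.ofReal_ne_top

lemma integrable_soft_sq {χ : ℝ} (hχ : 0 ≤ χ) :
    Integrable (fun z => soft z χ ^ 2) stdGaussian := by
  simpa using integrable_loss hχ 0

lemma soft_sq_midpoint_le {a b : ℝ} (ha : 0 ≤ a) (hb : 0 ≤ b) (z : ℝ) :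
    soft z ((a + b) / 2) ^ 2 ≤ (soft z a ^ 2 + soft z b ^ 2) / 2 := by
  rw [soft_sq (by positivity), soft_sq ha, soft_sq hb]
  have h1 : max (|z| - (a + b) / 2) 0 ≤ (max (|z| - a) 0 + max (|z| - b) 0) / 2 :=
    max_le (by linarith [le_max_left (|z| - a) 0, le_max_left (|z| - b) 0]) (by positivity)
  have h2 := pow_le_pow_left₀ (le_max_right _ _) h1 2
  nlinarith [sq_nonneg (max (|z| - a) 0 - max (|z| - b) 0)]

/-- Quadratic growth of `psi ε` away from a minimizer. -/
lemma psi_quadratic_growth {ε : ℝ} (hε : ε ∈ Ioo (0:ℝ) 1) {a b : ℝ} (ha : 0 ≤ a) (hb : 0 ≤ b)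
    (hmin : IsMinOn (psi ε) (Ici 0) a) : ε / 2 * (b - a) ^ 2 ≤ psi ε b - psi ε a := by
  have hm : psi ε a ≤ psi ε ((a + b) / 2) := hmin (show (0:ℝ) ≤ (a + b) / 2 by positivity)
  have h := integral_mono (integrable_soft_sq (show 0 ≤ (a + b) / 2 by positivity))
    (((integrable_soft_sq ha).add (integrable_soft_sq hb)).div_const 2)
    (fun z => soft_sq_midpoint_le ha hb z)
  simp only [Pi.add_apply] at h
  rw [integral_div, integral_add (integrable_soft_sq ha) (integrable_soft_sq hb)] at h
  have h' := mul_le_mul_of_nonneg_left h (show 0 ≤ 1 - ε by linarith [hε.2])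
  unfold psi at *
  nlinarith

lemma hasDerivAt_phi (x : ℝ) : HasDerivAt phi (-(x * phi x)) x := by
  have h : HasDerivAt (fun x : ℝ => -x ^ 2 / 2) (-x) x :=
    ((hasDerivAt_pow 2 x).neg.div_const 2).congr_deriv (by ring)
  exact (h.exp.const_mul (Real.sqrt (2 * Real.pi))⁻¹).congr_deriv (by unfold phi; ring)

lemma phi_pos (x : ℝ) : 0 < phi x := by unfold phi; positivity

lemma phi_sub_comm (x y : ℝ) : phi (x - y) = phi (y - x) := by
  unfold phi; congr 3; ring

lemma tendsto_phi_atTop : Tendsto phi atTop (nhds 0) := by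
  have h : Tendsto (fun x : ℝ => -x ^ 2 / 2) atTop atBot := by
    have := tendsto_neg_atTop_atBot.comp
      ((tendsto_pow_atTop (α := ℝ) two_ne_zero).atTop_div_const (zero_lt_two))
    refine this.congr fun x => ?_
    simp only [Function.comp]; ring
  have := (Real.tendsto_exp_atBot.comp h).const_mul (Real.sqrt (2 * Real.pi))⁻¹
  rw [mul_zero] at this
  exact this

lemma gaussianPDFReal_eq_phi (x : ℝ) : gaussianPDFReal 0 1 x = phi x := by
  simp [gaussianPDFReal, phi]

lemma integral_indicator_Ioi_stdGaussian {s : ℝ} (hs : 0 ≤ s) :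
    ∫ z, (Ioi s).indicator (fun z => z) z ∂stdGaussian = phi s := by
  unfold _root_.stdGaussian
  rw [integral_gaussianReal_eq_integral_smul one_ne_zero]
  have h : ∀ x : ℝ, gaussianPDFReal 0 1 x • (Ioi s).indicator (fun z => z) x =
      (Ioi s).indicator (fun z => z * phi z) x := fun x => by
    rw [gaussianPDFReal_eq_phi]
    by_cases hx : x ∈ Ioi s <;> simp [hx, mul_comm]
  simp_rw [h]
  rw [integral_indicator measurableSet_Ioi]
  have key := integral_Ioi_of_hasDerivAt_of_nonneg' (g := fun x => -phi x)
    (g' := fun x => x * phi x) (a := s) (l := 0)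
    (fun x _ => (hasDerivAt_phi x).neg.congr_deriv (neg_neg _))
    (fun x hx => mul_nonneg (hs.trans (le_of_lt hx)) (phi_pos x).le)
    (by simpa using tendsto_phi_atTop.neg)
  rw [key]; ring

lemma loss_diff_le {a b M θ t z : ℝ} (ha : 0 ≤ a) (hb : 0 ≤ b) (haM : a ≤ M) (hbM : b ≤ M)
    (hMt : M + 1 ≤ t) (hθ : θ ≤ -t) :
    |((soft (θ + z) a - θ) ^ 2 - a ^ 2 - 2 * a * z) -
      ((soft (θ + z) b - θ) ^ 2 - b ^ 2 - 2 * b * z)| ≤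
      (4 + 4 * M) * |a - b| * (Ioi (t - M)).indicator (fun z => z) z := by
  by_cases hz : z ∈ Ioi (t - M)
  · rw [indicator_of_mem hz]
    have hz1 : 1 ≤ z := by have : t - M < z := hz; linarith
    have h1 := abs_soft_sub_soft_le (u := θ + z) (a := a) (b := b)
    have h2 := abs_le.1 (abs_soft_sub_self_le (u := θ + z) ha)
    have h3 := abs_le.1 (abs_soft_sub_self_le (u := θ + z) hb)
    set p := soft (θ + z) a
    set q := soft (θ + z) b
    have e : ((p - θ) ^ 2 - a ^ 2 - 2 * a * z) - ((q - θ) ^ 2 - b ^ 2 - 2 * b * z) =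
        (p - q) * (p + q - 2 * θ) - (a - b) * (a + b + 2 * z) := by ring
    rw [e]
    have h4 : |p + q - 2 * θ| ≤ 2 * z + 2 * M :=
      abs_le.2 ⟨by linarith [h2.1, h3.1], by linarith [h2.2, h3.2]⟩
    have h5 : |a + b + 2 * z| ≤ 2 * z + 2 * M := abs_le.2 ⟨by linarith, by linarith⟩
    have hM : 0 ≤ M := ha.trans haM
    calc _ ≤ |p - q| * |p + q - 2 * θ| + |a - b| * |a + b + 2 * z| := by
          rw [← abs_mul, ← abs_mul]; exact abs_sub _ _
      _ ≤ |a - b| * (2 * z + 2 * M) + |a - b| * (2 * z + 2 * M) := by gcongr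
      _ ≤ _ := by nlinarith [mul_nonneg (abs_nonneg (a - b)) (mul_nonneg hM (sub_nonneg.2 hz1))]
  · rw [indicator_of_notMem hz]
    have hz' : z ≤ t - M := not_lt.1 hz
    rw [soft_of_le_neg ha (by linarith), soft_of_le_neg hb (by linarith), mul_zero]
    apply le_of_eq
    rw [abs_eq_zero]; ring

lemma risk_diff_le_of_neg {a b M θ t : ℝ} (ha : 0 ≤ a) (hb : 0 ≤ b) (haM : a ≤ M) (hbM : b ≤ M)
    (hMt : M + 1 ≤ t) (hθ : θ ≤ -t) :
    |(risk a θ - a ^ 2) - (risk b θ - b ^ 2)| ≤ (4 + 4 * M) * |a - b| * phi (t - M) := by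
  have hint : ∀ c : ℝ, 0 ≤ c →
      Integrable (fun z => (soft (θ + z) c - θ) ^ 2 - c ^ 2 - 2 * c * z) stdGaussian :=
    fun c hc => ((integrable_loss hc θ).sub (integrable_const _)).sub
      (integrable_id_stdGaussian.const_mul _)
  have hrisk : ∀ c : ℝ, 0 ≤ c →
      ∫ z, ((soft (θ + z) c - θ) ^ 2 - c ^ 2 - 2 * c * z) ∂stdGaussian = risk c θ - c ^ 2 := by
    intro c hc
    have hsub : Integrable (fun z => (soft (θ + z) c - θ) ^ 2 - c ^ 2) stdGaussian :=
      (integrable_loss hc θ).sub (integrable_const _)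
    rw [integral_sub hsub
      (integrable_id_stdGaussian.const_mul _),
      integral_sub (integrable_loss hc θ) (integrable_const _), integral_const_mul,
      integral_id_stdGaussian]
    simp [risk]
  rw [← hrisk a ha, ← hrisk b hb, ← integral_sub (hint a ha) (hint b hb),
    ← integral_indicator_Ioi_stdGaussian (s := t - M) (by linarith), ← integral_const_mul]
  rw [← Real.norm_eq_abs]
  exact norm_integral_le_of_norm_le
    ((integrable_id_stdGaussian.indicator measurableSet_Ioi).const_mul _)
    (ae_of_all _ fun z => loss_diff_le ha hb haM hbM hMt hθ)

lemma risk_diff_le {a b M θ t : ℝ} (ha : 0 ≤ a) (hb : 0 ≤ b) (haM : a ≤ M) (hbM : b ≤ M)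
    (hMt : M + 1 ≤ t) (hθ : t ≤ |θ|) :
    |(risk a θ - a ^ 2) - (risk b θ - b ^ 2)| ≤ (4 + 4 * M) * |a - b| * phi (t - M) := by
  rcases abs_cases θ with ⟨h, -⟩ | ⟨h, -⟩
  · rw [← risk_neg ha, ← risk_neg hb]
    exact risk_diff_le_of_neg ha hb haM hbM hMt (by linarith)
  · exact risk_diff_le_of_neg ha hb haM hbM hMt (by linarith)

lemma min_sq_le_two_mul_risk_of_nonneg {χ θ : ℝ} (hχ : 0 ≤ χ) (hθ : 0 ≤ θ) :
    min χ θ ^ 2 ≤ 2 * risk χ θ := by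
  have hpt : ∀ z, min χ θ ^ 2 ≤ (soft (θ + z) χ - θ) ^ 2 + (soft (θ + -z) χ - θ) ^ 2 := by
    have hneg : ∀ z ≤ 0, min χ θ ^ 2 ≤ (soft (θ + z) χ - θ) ^ 2 := by
      intro z hz
      have h : min χ θ ≤ θ - soft (θ + z) χ := by
        rw [soft_eq hχ]
        have := le_max_right (-(θ + z) - χ) 0
        rcases max_cases (θ + z - χ) 0 with ⟨k, k'⟩ | ⟨k, k'⟩ <;> rw [k]
        · linarith [min_le_left χ θ]
        · linarith [min_le_right χ θ]
      have := pow_le_pow_left₀ (le_min hχ hθ) h 2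
      nlinarith
    intro z
    rcases le_total z 0 with hz | hz
    · nlinarith [hneg z hz, sq_nonneg (soft (θ + -z) χ - θ)]
    · nlinarith [hneg (-z) (by linarith), sq_nonneg (soft (θ + z) χ - θ)]
  have hsymm := integral_neg_stdGaussian fun z => (soft (θ + z) χ - θ) ^ 2
  have hint' : Integrable (fun z => (soft (θ + -z) χ - θ) ^ 2) stdGaussian := by
    have h : Integrable (fun z => (soft (-θ + z) χ - -θ) ^ 2) stdGaussian :=
      integrable_loss hχ (-θ)
    refine h.congr (ae_of_all _ fun z => ?_)
    have : soft (-θ + z) χ = -soft (θ + -z) χ := by rw [← soft_neg hχ]; congr 1; ring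
    simp only [this]; ring
  have h := integral_mono (integrable_const (min χ θ ^ 2)) ((integrable_loss hχ θ).add hint') hpt
  simp only [Pi.add_apply] at h
  rw [integral_add (integrable_loss hχ θ) hint', hsymm] at h
  simp only [integral_const, probReal_univ, one_smul] at h
  unfold risk
  linarith

lemma min_sq_le_two_mul_risk {χ θ : ℝ} (hχ : 0 ≤ χ) : min χ |θ| ^ 2 ≤ 2 * risk χ θ := by
  rcases abs_cases θ with ⟨h, -⟩ | ⟨h, -⟩
  · simpa [h] using min_sq_le_two_mul_risk_of_nonneg hχ (h ▸ abs_nonneg θ)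
  · rw [h, ← risk_neg hχ]
    exact min_sq_le_two_mul_risk_of_nonneg hχ (h ▸ abs_nonneg θ)

section Minimizers

variable {ε μ σ : ℝ} {g : Measure ℝ} [IsProbabilityMeasure g]

lemma ae_div_le_abs_div (hσ : 0 < σ) (hG : g {x : ℝ | μ ≤ |x|} = 1) :
    ∀ᵐ b ∂g, μ / σ ≤ |b / σ| := by
  have h : ∀ᵐ b ∂g, μ ≤ |b| :=
    (prob_compl_eq_zero_iff (measurableSet_le measurable_const (by fun_prop))).2 hG
  filter_upwards [h] with b hb
  rw [abs_div, abs_of_pos hσ]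
  gcongr

/-- Comparison of a minimizer of the risk with a minimizer of `psi`. -/
lemma abs_sub_le_of_isMinOn (hε : ε ∈ Ioo (0:ℝ) 1) (hσ : 0 < σ)
    (hG : g {x : ℝ | μ ≤ |x|} = 1) {a b M : ℝ} (ha : 0 ≤ a) (hb : 0 ≤ b)
    (haM : a ≤ M) (hbM : b ≤ M) (hM : M + 1 ≤ μ / σ)
    (hamin : IsMinOn (fun χ => R1 ε g χ σ) (Ici 0) a) (hbmin : IsMinOn (psi ε) (Ici 0) b) :
    |a - b| ≤ (8 + 8 * M) * phi (μ / σ - M) := by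
  have h1 := psi_quadratic_growth hε hb ha hbmin
  have h2 : R1 ε g a σ ≤ R1 ε g b σ := hamin hb
  rw [R1_eq hε g ha, R1_eq hε g hb] at h2
  have hia : Integrable (fun x => risk a (x / σ) - a ^ 2) g :=
    (integrable_risk ha g σ).sub (integrable_const (a ^ 2))
  have hib : Integrable (fun x => risk b (x / σ) - b ^ 2) g :=
    (integrable_risk hb g σ).sub (integrable_const (b ^ 2))
  have h3 : |∫ x, ((risk a (x / σ) - a ^ 2) - (risk b (x / σ) - b ^ 2)) ∂g| ≤
      (4 + 4 * M) * |a - b| * phi (μ / σ - M) := by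
    have := norm_integral_le_of_norm_le (μ := g)
      (integrable_const ((4 + 4 * M) * |a - b| * phi (μ / σ - M)))
      (f := fun x => (risk a (x / σ) - a ^ 2) - (risk b (x / σ) - b ^ 2))
      ((ae_div_le_abs_div hσ hG).mono fun x hx => risk_diff_le ha hb haM hbM hM hx)
    simpa using this
  rw [integral_sub hia hib,
    integral_sub (integrable_risk ha g σ) (integrable_const _),
    integral_sub (integrable_risk hb g σ) (integrable_const _)] at h3
  simp only [integral_const, probReal_univ, one_smul] at h3
  have h4 : ε / 2 * (a - b) ^ 2 ≤ ε * ((4 + 4 * M) * |a - b| * phi (μ / σ - M)) := by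
    have := mul_le_mul_of_nonneg_left (neg_le_of_abs_le h3) hε.1.le
    unfold psi at h1
    nlinarith
  have h5 : |a - b| * |a - b| ≤ |a - b| * ((8 + 8 * M) * phi (μ / σ - M)) := by
    rw [abs_mul_abs_self]
    have := hε.1
    refine le_of_mul_le_mul_left ?_ (half_pos this)
    nlinarith
  rcases (abs_nonneg (a - b)).eq_or_lt with h | h
  · rw [← h]
    have := (phi_pos (μ / σ - M)).le
    have : 0 ≤ M := ha.trans haM
    positivity
  · exact le_of_mul_le_mul_left h5 h

/-- Minimizers of the risk stay bounded as the noise level decreases. -/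
lemma le_of_isMinOn_R1 (hε : ε ∈ Ioo (0:ℝ) 1) (hσ : 0 < σ) (hμ : 0 < μ)
    (hG : g {x : ℝ | μ ≤ |x|} = 1) {a K : ℝ} (ha : 0 ≤ a) (hK : 0 ≤ K) (hKε : 4 < ε * K ^ 2)
    (hKσ : K < μ / σ) (hamin : IsMinOn (fun χ => R1 ε g χ σ) (Ici 0) a) : a ≤ K := by
  have h0 : R1 ε g a σ ≤ R1 ε g 0 σ := hamin (le_refl (0:ℝ))
  rw [R1_eq hε g ha, R1_eq hε g le_rfl] at h0
  have hup : ∫ b, risk 0 (b / σ) ∂g ≤ 2 := by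
    have := integral_mono (integrable_risk le_rfl g σ) (integrable_const (2:ℝ))
      (fun b => by simpa using risk_le le_rfl (b / σ))
    simpa using this
  have hz : ∫ z, soft z 0 ^ 2 ∂stdGaussian ≤ 2 := by
    simpa [risk] using risk_le (χ := 0) le_rfl 0
  have hlow : min a (μ / σ) ^ 2 ≤ 2 * ∫ b, risk a (b / σ) ∂g := by
    have := integral_mono_ae (integrable_const (min a (μ / σ) ^ 2))
      ((integrable_risk ha g σ).const_mul 2)
      ((ae_div_le_abs_div hσ hG).mono fun b hb =>
        le_trans (pow_le_pow_left₀ (le_min ha (by positivity)) (min_le_min_left a hb) 2)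
          (min_sq_le_two_mul_risk ha))
    rw [integral_const_mul] at this
    simpa using this
  have hnn : 0 ≤ ∫ z, soft z a ^ 2 ∂stdGaussian := integral_nonneg fun _ => sq_nonneg _
  obtain ⟨he0, he1⟩ := hε
  have h6 : ε * min a (μ / σ) ^ 2 ≤ 4 := by
    nlinarith [mul_nonneg (sub_nonneg.2 he1.le) hnn,
      mul_le_mul_of_nonneg_left hz (sub_nonneg.2 he1.le), mul_le_mul_of_nonneg_left hup he0.le,
      mul_le_mul_of_nonneg_left hlow he0.le]
  by_contra! hlt
  have h7 : K ≤ min a (μ / σ) := le_min hlt.le hKσ.le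
  have h8 := mul_le_mul_of_nonneg_left (pow_le_pow_left₀ hK h7 2) he0.le
  linarith

end Minimizers

lemma phi_sub_le_exp_mul {s δ : ℝ} : phi (s - δ) ≤ exp (s * δ) * phi s := by
  unfold phi
  rw [mul_left_comm, ← Real.exp_add]
  gcongr
  nlinarith [sq_nonneg δ]

lemma tendsto_mul_phi_atTop : Tendsto (fun x => x * phi x) atTop (nhds 0) := by
  have h := (Real.tendsto_pow_mul_exp_neg_atTop_nhds_zero 1).const_mul
    (Real.sqrt (2 * Real.pi))⁻¹
  rw [mul_zero] at h
  refine tendsto_of_tendsto_of_tendsto_of_le_of_le' tendsto_const_nhds h ?_ ?_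
  · filter_upwards [eventually_ge_atTop 0] with x hx using mul_nonneg hx (phi_pos x).le
  · filter_upwards [eventually_ge_atTop 2] with x hx
    unfold phi
    rw [mul_left_comm, pow_one]
    have : rexp (-x ^ 2 / 2) ≤ rexp (-x) := Real.exp_le_exp.2 (by nlinarith)
    gcongr

lemma tendsto_mul_phi_sub_atTop (M : ℝ) :
    Tendsto (fun x => x * phi (x - M)) atTop (nhds 0) := by
  have hs : Tendsto (fun x : ℝ => x - M) atTop atTop := tendsto_atTop_add_const_right _ _ tendsto_id
  have := (tendsto_mul_phi_atTop.comp hs).add ((tendsto_phi_atTop.comp hs).const_mul M)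
  rw [mul_zero, add_zero] at this
  refine this.congr fun x => ?_
  simp only [Function.comp]; ring

/-- If `P(|G| ≥ μ) = 1` for some `μ > 0` and `E[G²] < ∞`, then as `σ → 0⁺`:
`|χ*(σ) − χ**| = O(φ(χ** − μ/σ))`, where `χ*(σ)` is the minimizer of `χ ↦ R(χ,σ)` over
`[0,∞)` and `χ**` is the unique minimizer of `ψ` over `[0,∞)`. -/
theorem chi_star_convergence_rate
    (ε μ : ℝ) (hε : ε ∈ Ioo (0:ℝ) 1) (hμ : 0 < μ)
    (g : Measure ℝ) [IsProbabilityMeasure g] (hg0 : g {0} = 0)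
    (hG2 : Integrable (fun x => x^2) g)
    (hGμ : g {x : ℝ | μ ≤ |x|} = 1)
    (χstar : ℝ → ℝ)
    (hχstar : ∀ σ, 0 < σ → χstar σ ∈ Ici (0:ℝ) ∧
      IsMinOn (fun χ => R1 ε g χ σ) (Ici 0) (χstar σ))
    (χss : ℝ) (hχss0 : χss ∈ Ici (0:ℝ)) (hχssmin : IsMinOn (psi ε) (Ici 0) χss)
    (hχssuniq : ∀ c' ∈ Ici (0:ℝ), IsMinOn (psi ε) (Ici 0) c' → c' = χss) :
    (fun σ => |χstar σ - χss|)
      =O[nhdsWithin (0:ℝ) (Ioi 0)] (fun σ => phi (χss - μ/σ)) := by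
  obtain ⟨K, hK0, hK⟩ : ∃ K : ℝ, 0 ≤ K ∧ 4 < ε * K ^ 2 := by
    have hε0 := hε.1
    refine ⟨4 / ε, by positivity, ?_⟩
    have : ε * (4 / ε) ^ 2 = 16 / ε := by field_simp; norm_num
    rw [this, lt_div_iff₀ hε0]
    linarith [hε.2]
  have hss : 0 ≤ χss := hχss0
  set M := max K χss
  have hM0 : 0 ≤ M := hK0.trans (le_max_left _ _)
  have hx : Tendsto (fun σ => μ / σ) (nhdsWithin 0 (Ioi 0)) atTop :=
    tendsto_inv_nhdsGT_zero.const_mul_atTop hμ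
  have hδ : Tendsto (fun x => (8 + 8 * M) * (x * phi (x - M))) atTop (nhds 0) := by
    simpa using (tendsto_mul_phi_sub_atTop M).const_mul (8 + 8 * M)
  refine IsBigO.of_bound ((8 + 8 * (χss + 1)) * exp 1) ?_
  filter_upwards [self_mem_nhdsWithin, hx.eventually_ge_atTop (M + 2),
    hx.eventually (hδ.eventually_le_const zero_lt_one)] with σ hσ hMσ hδσ
  obtain ⟨hs0, hsmin⟩ := hχstar σ hσ
  replace hs0 : 0 ≤ χstar σ := hs0
  set x := μ / σ
  set δ := (8 + 8 * M) * phi (x - M)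
  have hKM : K ≤ M := le_max_left _ _
  have hsM : χss ≤ M := le_max_right _ _
  have hstarK : χstar σ ≤ K :=
    le_of_isMinOn_R1 hε hσ hμ hGμ hs0 hK0 hK (by linarith) hsmin
  have hcrude : |χstar σ - χss| ≤ δ :=
    abs_sub_le_of_isMinOn hε hσ hGμ hs0 hss (hstarK.trans hKM) hsM (by linarith) hsmin hχssmin
  have hδ0 : 0 ≤ δ := (abs_nonneg _).trans hcrude
  have hxδ : x * δ ≤ 1 := by
    calc x * δ = (8 + 8 * M) * (x * phi (x - M)) := by simp only [δ]; ring
      _ ≤ 1 := hδσ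
  have hδ1 : δ ≤ 1 := by nlinarith
  have hfine : |χstar σ - χss| ≤ (8 + 8 * (χss + δ)) * phi (x - (χss + δ)) :=
    abs_sub_le_of_isMinOn hε hσ hGμ hs0 hss (by linarith [le_abs_self (χstar σ - χss)])
      (by linarith) (by linarith) hsmin hχssmin
  rw [Real.norm_eq_abs, abs_abs, Real.norm_eq_abs, abs_of_pos (phi_pos _), phi_sub_comm χss]
  have hphi : phi (x - (χss + δ)) ≤ exp 1 * phi (x - χss) := by
    rw [← sub_sub]
    refine phi_sub_le_exp_mul.trans ?_
    have := (phi_pos (x - χss)).le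
    gcongr
    nlinarith [mul_nonneg hss hδ0]
  calc _ ≤ _ := hfine
    _ ≤ (8 + 8 * (χss + 1)) * (exp 1 * phi (x - χss)) := by
        have := (phi_pos (x - (χss + δ))).le
        gcongr
    _ = _ := by ring
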